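/- Let n ≥ 2 and let 1 ≤ s_1 < s_2 < … < s_k < n be integers with gcd(s_1,…,s_k,n) = 1. Then the number of spanning trees τ(n) of the circulant graph C_{2n}(s_1,…,s_k,n) is given by τ(n) = (n · 4^{s_k−1}/q) · ∏_{p=1}^{s_k−1} (T_n(u_p) − 1) · ∏_{p=1}^{s_k} (T_n(v_p) + 1), where q = s_1² + … + s_k², P(w) = 2k + 1 − 2∑_{j=1}^{k} T_{s_j}(w), the u_p are the complex roots different from 1 (with multiplicity) of P(u) − 1 = 0, and the v_p are the complex roots (with multiplicity) of P(v) + 1 = 0. -/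

import Mathlib

open Polynomial Complex Finset
open scoped Classical

/-- The circulant graph `C_n(s 0, …, s (k-1))` on vertex set `ZMod n`:
`i` is adjacent to `i ± s j (mod n)` for each `j`. -/
def circulant (n : ℕ) {k : ℕ} (s : Fin k → ℕ) : SimpleGraph (ZMod n) :=
  SimpleGraph.circulantGraph {x : ZMod n | ∃ j : Fin k, x = (s j : ZMod n)}

/-- The odd-valency circulant graph `C_{2n}(s 0, …, s (k-1), n)` on vertex set `ZMod (2n)`:
`i` is adjacent to `i ± s j (mod 2n)` for each `j`, and to `i + n (mod 2n)`. -/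
def circulantOdd (n : ℕ) {k : ℕ} (s : Fin k → ℕ) : SimpleGraph (ZMod (2 * n)) :=
  SimpleGraph.circulantGraph
    ({x : ZMod (2 * n) | ∃ j : Fin k, x = (s j : ZMod (2 * n))} ∪ {(n : ZMod (2 * n))})

/-- The number of spanning trees of `G`: the number of subgraphs of `G` (on the same
vertex set) that are trees. -/
noncomputable def numSpanningTrees {V : Type*} (G : SimpleGraph V) : ℕ :=
  Set.ncard {H : SimpleGraph V | H ≤ G ∧ H.IsTree}

section ParentGraph

variable {V : Type*}

/-- The graph joining every vertex to its image under `f`. -/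
def parentGraph (f : V → V) : SimpleGraph V :=
  SimpleGraph.fromRel fun u v => v = f u

/-- If every vertex reaches the root under iteration of `f`, some depth function decreases
along `f`. -/
theorem exists_depth {f : V → V} {r : V} (h : ∀ v, ∃ m, f^[m] v = r) :
    ∃ d : V → ℕ, ∀ v, v ≠ r → d (f v) < d v := by
  refine ⟨fun v => Nat.find (h v), fun v hv => ?_⟩
  have h0 : Nat.find (h v) ≠ 0 := fun h0 => hv (by simpa [h0] using Nat.find_spec (h v))
  have h1 : f^[Nat.find (h v) - 1] (f v) = r := by
    rw [← Function.iterate_succ_apply, Nat.succ_eq_add_one, Nat.sub_add_cancel (by omega)]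
    exact Nat.find_spec (h v)
  have := Nat.find_min' (h (f v)) h1
  beta_reduce
  omega

theorem parentGraph_connected {f : V → V} {r : V} (h : ∀ v, ∃ m, f^[m] v = r) :
    (parentGraph f).Connected := by
  have hreach : ∀ m v, f^[m] v = r → (parentGraph f).Reachable v r := by
    intro m
    induction m with
    | zero => rintro v rfl; exact SimpleGraph.Reachable.refl _
    | succ m ih =>
      intro v hv
      refine SimpleGraph.Reachable.trans ?_ (ih (f v) hv)
      by_cases hfv : v = f v
      · rw [← hfv]
      · exact SimpleGraph.Adj.reachable ⟨hfv, Or.inl rfl⟩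
  have hreach' : ∀ v, (parentGraph f).Reachable v r := fun v => (h v).elim fun m hm => hreach m v hm
  have : Nonempty V := ⟨r⟩
  exact ⟨fun u v => (hreach' u).trans (hreach' v).symm⟩

/-- The path from `v` to the root in the parent graph starts with the edge from `v` to `f v`. -/
theorem parentGraph_exists_isPath {f : V → V} {r : V} (hr : f r = r) (h : ∀ v, ∃ m, f^[m] v = r)
    (v : V) : ∃ p : (parentGraph f).Walk v r, p.IsPath ∧ p.snd = f v := by
  obtain ⟨d, hd⟩ := exists_depth h
  suffices H : ∀ m v, d v = m → ∃ p : (parentGraph f).Walk v r, p.IsPath ∧ p.snd = f v ∧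
      ∀ u ∈ p.support, d u ≤ m by
    obtain ⟨p, hp, hs, -⟩ := H _ v rfl
    exact ⟨p, hp, hs⟩
  intro m
  induction m using Nat.strong_induction_on with
  | _ m ih =>
    rintro v rfl
    by_cases hv : v = r
    · subst hv
      exact ⟨SimpleGraph.Walk.nil, SimpleGraph.Walk.IsPath.nil, by simp [hr], by simp⟩
    · have hlt := hd v hv
      obtain ⟨p, hp, -, hsup⟩ := ih _ hlt (f v) rfl
      have hadj : (parentGraph f).Adj v (f v) :=
        ⟨fun hvf => by rw [← hvf] at hlt; exact lt_irrefl _ hlt, Or.inl rfl⟩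
      refine ⟨SimpleGraph.Walk.cons hadj p, hp.cons fun hmem => ?_, by simp, ?_⟩
      · exact absurd (hsup v hmem) (by omega)
      · intro u hu
        rw [SimpleGraph.Walk.support_cons, List.mem_cons] at hu
        rcases hu with rfl | hu
        · exact le_rfl
        · exact (hsup u hu).trans hlt.le

theorem exists_parentGraph_eq {T : SimpleGraph V} (hT : T.IsTree) (r : V) :
    ∃ f : V → V, f r = r ∧ (∀ v, v ≠ r → T.Adj v (f v)) ∧ (∀ v, ∃ m, f^[m] v = r) ∧
      parentGraph f = T := by
  have hstep : ∀ v, ∃ w, (v = r → w = r) ∧ (v ≠ r → T.Adj v w ∧ T.dist w r < T.dist v r) := by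
    intro v
    by_cases hv : v = r
    · exact ⟨r, fun _ => rfl, fun h => absurd hv h⟩
    · obtain ⟨p, hp⟩ := (hT.connected v r).exists_walk_length_eq_dist
      cases p with
      | nil => exact absurd rfl hv
      | @cons _ w _ hadj q =>
        refine ⟨w, fun h => absurd h hv, fun _ => ⟨hadj, ?_⟩⟩
        rw [← hp, SimpleGraph.Walk.length_cons]
        exact Nat.lt_succ_of_le (SimpleGraph.dist_le q)
  choose f hf1 hf2 using hstep
  have hreach : ∀ v, ∃ m, f^[m] v = r := by
    suffices H : ∀ m v, T.dist v r = m → ∃ m, f^[m] v = r from fun v => H _ v rfl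
    intro m
    induction m using Nat.strong_induction_on with
    | _ m ih =>
      rintro v rfl
      by_cases hv : v = r
      · exact ⟨0, hv⟩
      · obtain ⟨k, hk⟩ := ih _ (hf2 v hv).2 (f v) rfl
        exact ⟨k + 1, hk⟩
  have hle : parentGraph f ≤ T := by
    rintro u v ⟨huv, rfl | rfl⟩
    · exact (hf2 u fun h => huv (h.trans (hf1 u h).symm)).1
    · exact (hf2 v fun h => huv ((hf1 v h).trans h.symm)).1.symm
  refine ⟨f, hf1 r rfl, fun v hv => (hf2 v hv).1, hreach, le_antisymm hle ?_⟩
  exact (SimpleGraph.isTree_iff_minimal_connected.mp hT).le_of_le (parentGraph_connected hreach) hle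

end ParentGraph

section MatrixTree

variable {V : Type*} [Fintype V] [DecidableEq V]

theorem parentGraph_isTree {f : V → V} {r : V} (hr : f r = r) (h : ∀ v, ∃ m, f^[m] v = r) :
    (parentGraph f).IsTree := by
  have hconn := parentGraph_connected h
  rw [SimpleGraph.isTree_iff_connected_and_card]
  refine ⟨hconn, le_antisymm ?_ hconn.card_vert_le_card_edgeSet_add_one⟩
  have hsub : (parentGraph f).edgeSet ⊆
      ((Finset.univ.erase r).image fun v => s(v, f v) : Finset (Sym2 V)) := by
    intro e
    induction e with
    | _ u v =>
      rintro ⟨huv : u ≠ v, (hv : v = f u) | (hu : u = f v)⟩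
      · have : u ≠ r := by rintro rfl; exact huv (hv.trans hr).symm
        simpa using ⟨u, this, Or.inl ⟨rfl, hv.symm⟩⟩
      · have : v ≠ r := by rintro rfl; exact huv (hu.trans hr)
        simpa using ⟨v, this, Or.inr ⟨rfl, hu.symm⟩⟩
  have hcard : Nat.card (parentGraph f).edgeSet ≤ (Finset.univ.erase r).card := by
    rw [Nat.card_coe_set_eq]
    refine (Set.ncard_le_ncard hsub (Finset.finite_toSet _)).trans ?_
    rw [Set.ncard_coe_finset]
    exact Finset.card_image_le
  rw [Finset.card_erase_of_mem (Finset.mem_univ r), Finset.card_univ] at hcard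
  have : 0 < Fintype.card V := Fintype.card_pos_iff.mpr ⟨r⟩
  rw [Nat.card_eq_fintype_card (α := V)]
  omega

theorem parentGraph_injOn (r : V) :
    Set.InjOn parentGraph {f : V → V | f r = r ∧ ∀ v, ∃ m, f^[m] v = r} := by
  rintro f ⟨hf, hf'⟩ g ⟨hg, hg'⟩ hfg
  ext v
  obtain ⟨p, hp, hps⟩ := parentGraph_exists_isPath hf hf' v
  have := parentGraph_exists_isPath hg hg' v
  rw [← hfg] at this
  obtain ⟨q, hq, hqs⟩ := this
  rw [← hps, ← hqs, ((parentGraph_isTree hf hf').existsUnique_path v r).unique hp hq]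

/-- The determinant of `1 - N`, where `N` is the transition matrix of a self-map `f` with the row of
the root removed, detects whether every vertex reaches the root under iteration of `f`. -/
theorem det_one_sub_transition (f : V → V) (r : V) (hf : f r = r) :
    (Matrix.of fun i j => (Pi.single i 1 : V → ℂ) j -
      (if i = r then 0 else Pi.single (f i) 1 : V → ℂ) j).det =
      if ∀ v, ∃ m, f^[m] v = r then 1 else 0 := by
  split_ifs with h
  · obtain ⟨d, hd⟩ := exists_depth h
    have htri : Matrix.BlockTriangular (Matrix.of fun i j => (Pi.single i 1 : V → ℂ) j -
      (if i = r then 0 else Pi.single (f i) 1 : V → ℂ) j) (OrderDual.toDual ∘ d) := by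
      intro i j hij
      have hij : d i < d j := hij
      have h1 : j ≠ i := by rintro rfl; omega
      rw [Matrix.of_apply, Pi.single_eq_of_ne h1]
      split_ifs with hi
      · simp
      · have := hd i hi
        have h2 : j ≠ f i := by rintro rfl; omega
        rw [Pi.single_eq_of_ne h2, sub_zero]
    rw [htri.det]
    refine Finset.prod_eq_one fun a _ => ?_
    refine (congrArg Matrix.det ?_).trans Matrix.det_one
    ext ⟨i, hi⟩ ⟨j, hj⟩
    have hij : d i = d j := OrderDual.toDual.injective (hi.trans hj.symm)
    simp only [Matrix.toSquareBlock_def, Matrix.of_apply, Matrix.one_apply, Subtype.mk.injEq]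
    have : (if i = r then 0 else Pi.single (f i) 1 : V → ℂ) j = 0 := by
      split_ifs with hir
      · rfl
      · have := hd i hir
        have h2 : j ≠ f i := by rintro rfl; omega
        rw [Pi.single_eq_of_ne h2]
    rw [this, sub_zero, Pi.single_apply]
    simp only [eq_comm]
  · push Not at h
    obtain ⟨v, hv⟩ := h
    refine Matrix.exists_mulVec_eq_zero_iff.mp
      ⟨fun i => if ∃ m, f^[m] i = r then 0 else 1, ?_, ?_⟩
    · intro h0
      have := congrFun h0 v
      rw [if_neg (by push Not; exact hv)] at this
      exact one_ne_zero this
    · ext i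
      have key : (∃ m, f^[m] (f i) = r) ↔ ∃ m, f^[m] i = r := by
        constructor
        · rintro ⟨m, hm⟩
          exact ⟨m + 1, hm⟩
        · rintro ⟨m, hm⟩
          refine ⟨m, ?_⟩
          rw [← Function.iterate_succ_apply, Function.iterate_succ_apply', hm, hf]
      have hmul : ∀ x : V → ℂ, ((Matrix.of fun i j => (Pi.single i 1 : V → ℂ) j -
          (if i = r then 0 else Pi.single (f i) 1 : V → ℂ) j).mulVec x) i =
          x i - if i = r then 0 else x (f i) := by
        intro x
        by_cases hi : i = r <;>
          simp [Matrix.mulVec, dotProduct, Pi.single_apply, hi, sub_mul, Finset.sum_sub_distrib]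
      rw [hmul]
      by_cases hi : i = r
      · have : ∃ m, f^[m] i = r := ⟨0, hi⟩
        rw [if_pos hi, if_pos this, sub_zero, Pi.zero_apply]
      · simp [hi, key]

/-- Expanding the determinant along choices of an outgoing edge at every vertex but the root. -/
theorem det_lapMatrix_updateRow_single_eq_card (G : SimpleGraph V) [DecidableRel G.Adj] (r : V) :
    ((G.lapMatrix ℂ).updateRow r (Pi.single r 1)).det =
      (Finset.univ.filter fun f : V → V =>
        (f r = r ∧ ∀ i, i ≠ r → G.Adj i (f i)) ∧ ∀ v, ∃ m, f^[m] v = r).card := by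
  let A : V → Finset V := fun i => if i = r then {r} else G.neighborFinset i
  let g : V → V → V → ℂ := fun i j =>
    Pi.single i 1 - (if i = r then 0 else Pi.single j 1)
  have hrow : (G.lapMatrix ℂ).updateRow r (Pi.single r 1) = fun i => ∑ j ∈ A i, g i j := by
    ext i j
    by_cases hi : i = r
    · subst hi
      simp [A, g]
    · simp [A, g, hi, Matrix.updateRow_ne, SimpleGraph.lapMatrix, SimpleGraph.degMatrix,
        Matrix.diagonal_apply, SimpleGraph.adjMatrix_apply, Finset.sum_apply, Pi.single_apply,
        eq_comm (a := j)]
  have hdet := (Matrix.detRowAlternating (R := ℂ) (n := V)).toMultilinearMap.map_sum_finset g A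
  rw [hrow]
  refine hdet.trans ?_
  have hA : ∀ f : V → V, f ∈ Fintype.piFinset A ↔ f r = r ∧ ∀ i, i ≠ r → G.Adj i (f i) := by
    intro f
    rw [Fintype.mem_piFinset]
    constructor
    · intro h
      refine ⟨by simpa [A] using h r, fun i hi => by simpa [A, hi] using h i⟩
    · rintro ⟨h1, h2⟩ i
      by_cases hi : i = r
      · subst hi; simp [A, h1]
      · simpa [A, hi] using h2 i hi
  have : ∀ f ∈ Fintype.piFinset A,
      (Matrix.detRowAlternating (R := ℂ) (n := V)).toMultilinearMap (fun i => g i (f i)) =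
        if ∀ v, ∃ m, f^[m] v = r then 1 else 0 := by
    intro f hf
    exact det_one_sub_transition f r ((hA f).mp hf).1
  rw [Finset.sum_congr rfl this, Finset.sum_boole, ← Finset.filter_filter]
  congr 3
  ext f
  simp [hA]

/-- The matrix tree theorem, with the reduced Laplacian presented as the Laplacian whose row at the
root is replaced by the corresponding standard basis vector. -/
theorem det_lapMatrix_updateRow_single (G : SimpleGraph V) [DecidableRel G.Adj] (r : V) :
    ((G.lapMatrix ℂ).updateRow r (Pi.single r 1)).det = numSpanningTrees G := by
  rw [det_lapMatrix_updateRow_single_eq_card, numSpanningTrees, ← Set.ncard_coe_finset]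
  congr 1
  rw [← ((parentGraph_injOn r).mono _).ncard_image]
  · congr 1
    ext T
    simp only [Finset.coe_filter, Finset.mem_univ, true_and, Set.mem_image, Set.mem_ofPred_eq]
    constructor
    · rintro ⟨f, ⟨⟨hf, hadj⟩, hreach⟩, rfl⟩
      refine ⟨?_, parentGraph_isTree hf hreach⟩
      rintro u v ⟨huv, rfl | rfl⟩
      · exact hadj u (by rintro rfl; exact huv hf.symm)
      · exact (hadj v (by rintro rfl; exact huv hf)).symm
    · rintro ⟨hle, hT⟩
      obtain ⟨f, hf, hadj, hreach, rfl⟩ := exists_parentGraph_eq hT r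
      exact ⟨f, ⟨⟨hf, fun v hv => hle (hadj v hv)⟩, hreach⟩, rfl⟩
  · intro f hf
    simp only [Finset.coe_filter, Finset.mem_univ, true_and, Set.mem_ofPred_eq] at hf
    exact ⟨hf.1.1, hf.2⟩

/-- Adding the all-ones matrix to the Laplacian. -/
theorem det_lapMatrix_add_ones (G : SimpleGraph V) [DecidableRel G.Adj] [Nonempty V] :
    (G.lapMatrix ℂ + Matrix.of fun _ _ => 1).det =
      (Fintype.card V : ℂ) ^ 2 * numSpanningTrees G := by
  obtain ⟨r⟩ := ‹Nonempty V›
  set L := G.lapMatrix ℂ with hL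
  set J : Matrix V V ℂ := Matrix.of fun _ _ => 1 with hJ
  set N : ℂ := (Fintype.card V : ℂ) with hN
  have hsym : ∀ i j, L i j = L j i := fun i j => (G.isSymm_lapMatrix (R := ℂ)).apply j i
  have hker : ∀ i, ∑ j, L i j = 0 := by
    intro i
    have := congrFun (G.lapMatrix_mulVec_const_eq_zero (R := ℂ)) i
    simpa [Matrix.mulVec, dotProduct] using this
  have hsum : ∑ k, (1 : ℂ) • (L + J) k = N • fun _ => 1 := by
    ext j
    refine (Finset.sum_apply j _ _).trans ?_
    simp [Finset.sum_add_distrib, hsym _ j, hker, hJ, hN]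
  have h1 := Matrix.det_updateRow_sum (L + J) r fun _ => 1
  rw [hsum, Matrix.det_updateRow_smul, one_smul] at h1
  have h2 : ((L + J).updateRow r fun _ => 1).det = (L.updateRow r fun _ => 1).det := by
    refine Matrix.det_eq_of_forall_row_eq_smul_add_const (fun i => if i = r then 0 else 1) r
      (by simp) fun i j => ?_
    by_cases hi : i = r
    · subst hi; simp
    · simp [hi, hJ]
  have h3 : (fun _ => 1 : V → ℂ) = N • Pi.single r 1 + ((fun _ => 1) - N • Pi.single r 1) := by
    ext; simp
  have h4 : (L.updateRow r ((fun _ => 1) - N • Pi.single r 1)).det = 0 := by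
    refine Matrix.exists_mulVec_eq_zero_iff.mp ⟨fun _ => 1, fun h => ?_, ?_⟩
    · exact one_ne_zero (congrFun h r)
    · ext i
      by_cases hi : i = r
      · subst hi
        simp [Matrix.mulVec, dotProduct, Finset.sum_sub_distrib, hN, ← Finset.mul_sum]
      · simp [Matrix.mulVec, dotProduct, hi, hker]
  rw [← h1, h2, h3, Matrix.det_updateRow_add, h4, Matrix.det_updateRow_smul,
    det_lapMatrix_updateRow_single]
  ring

end MatrixTree

section Circulant

variable {N : ℕ} [NeZero N]

/-- The character table of `ZMod N` is invertible. -/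
theorem det_stdAddChar_mul_ne_zero :
    (Matrix.of fun i j : ZMod N => (ZMod.stdAddChar (i * j) : ℂ)).det ≠ 0 := by
  have h : (Matrix.of fun i j : ZMod N => (ZMod.stdAddChar (i * j) : ℂ)) *
      (Matrix.of fun i j : ZMod N => (ZMod.stdAddChar (-(i * j)) : ℂ)) = (N : ℂ) • 1 := by
    ext i j
    have := AddChar.sum_mulShift (i - j) (ZMod.isPrimitive_stdAddChar N)
    simp only [Matrix.mul_apply, Matrix.of_apply, ← AddChar.map_add_eq_mul]
    rw [Matrix.smul_apply, Matrix.one_apply]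
    refine (Finset.sum_congr rfl fun x _ => ?_).trans (this.trans ?_)
    · congr 1; ring
    · simp [sub_eq_zero, ZMod.card]
  intro h0
  have := congrArg Matrix.det h
  rw [Matrix.det_mul, h0, zero_mul, Matrix.det_smul, Matrix.det_one, mul_one] at this
  exact pow_ne_zero _ (NeZero.ne _) this.symm

/-- The number of spanning trees of a Cayley graph of `ZMod N` in terms of the nonzero characters;
the connection set is the range of an injective family `J`. -/
theorem card_mul_numSpanningTrees_eq_prod {ι : Type*} [Fintype ι] (G : SimpleGraph (ZMod N))
    (J : ι → ZMod N) (hJ : Function.Injective J) (hG : ∀ u v, G.Adj u v ↔ ∃ x, v = u + J x) :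
    (N : ℂ) * numSpanningTrees G =
      ∏ m ∈ Finset.univ.erase (0 : ZMod N), ∑ x, (1 - ZMod.stdAddChar (J x * m) : ℂ) := by
  set F : Matrix (ZMod N) (ZMod N) ℂ :=
    Matrix.of fun i j : ZMod N => (ZMod.stdAddChar (i * j) : ℂ) with hF
  set ev : ZMod N → ℂ :=
    fun m => if m = 0 then (N : ℂ) else ∑ x, (1 - ZMod.stdAddChar (J x * m) : ℂ) with hev
  have hlap : ∀ i (y : ZMod N → ℂ),
      ((G.lapMatrix ℂ).mulVec y) i = ∑ x, (y i - y (i + J x)) := by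
    intro i y
    have hn : G.neighborFinset i = Finset.univ.image fun x => i + J x := by
      ext v
      simp [hG, eq_comm]
    have hinj : Function.Injective fun x => i + J x := fun a b hab => hJ (add_left_cancel hab)
    rw [SimpleGraph.lapMatrix_mulVec_apply, hn, Finset.sum_image hinj.injOn,
      ← SimpleGraph.card_neighborFinset_eq_degree, hn, Finset.card_image_of_injective _ hinj,
      Finset.sum_sub_distrib]
    simp
  have hmul : (G.lapMatrix ℂ + Matrix.of fun _ _ => 1) * F = F * Matrix.diagonal ev := by
    ext i m
    have h1 : (G.lapMatrix ℂ * F) i m =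
        F i m * ∑ x, (1 - ZMod.stdAddChar (J x * m) : ℂ) := by
      refine (hlap i fun j => F j m).trans ?_
      rw [Finset.mul_sum]
      refine Finset.sum_congr rfl fun x _ => ?_
      simp only [hF, Matrix.of_apply, add_mul, AddChar.map_add_eq_mul]
      ring
    have h2 : ((Matrix.of fun _ _ => 1 : Matrix (ZMod N) (ZMod N) ℂ) * F) i m =
        if m = 0 then (N : ℂ) else 0 := by
      have := AddChar.sum_mulShift m (ZMod.isPrimitive_stdAddChar N)
      simpa [Matrix.mul_apply, hF, ZMod.card] using this
    rw [add_mul, Matrix.add_apply, h1, h2, Matrix.mul_diagonal]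
    by_cases hm : m = 0
    · simp [hm, hev, hF]
    · simp [hm, hev]
  have hdet := congrArg Matrix.det hmul
  rw [Matrix.det_mul, Matrix.det_mul, mul_comm] at hdet
  have hdet := mul_left_cancel₀ (det_stdAddChar_mul_ne_zero (N := N)) hdet
  rw [det_lapMatrix_add_ones, Matrix.det_diagonal, ZMod.card,
    ← Finset.mul_prod_erase _ _ (Finset.mem_univ (0 : ZMod N))] at hdet
  have hN : (N : ℂ) ≠ 0 := NeZero.ne _
  apply mul_left_cancel₀ hN
  rw [← mul_assoc, ← pow_two, hdet]
  congr 1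
  · simp [hev]
  · exact Finset.prod_congr rfl fun m hm => if_neg (Finset.ne_of_mem_erase hm)

theorem prod_univ_erase_zero_eq_prod_range {M : Type*} [CommMonoid M] (g : ZMod N → M) :
    ∏ m ∈ Finset.univ.erase (0 : ZMod N), g m = ∏ i ∈ (Finset.range N).erase 0, g i := by
  refine Finset.prod_nbij' (fun m => m.val) (fun i => (i : ZMod N)) ?_ ?_ ?_ ?_ ?_
  · intro m hm
    simpa [ZMod.val_lt] using hm
  · intro i hi
    simp only [Finset.mem_erase, Finset.mem_range, Finset.mem_univ, and_true] at hi ⊢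
    intro h0
    have := congrArg ZMod.val h0
    rw [ZMod.val_natCast_of_lt hi.2, ZMod.val_zero] at this
    exact hi.1 this
  · simp
  · intro i hi
    simp only [Finset.mem_erase, Finset.mem_range] at hi
    exact ZMod.val_natCast_of_lt hi.2
  · simp

end Circulant

theorem prod_range_two_mul_erase_zero {M : Type*} [CommMonoid M] {n : ℕ} (hn : 0 < n)
    (f : ℕ → M) :
    ∏ i ∈ (Finset.range (2 * n)).erase 0, f i =
      (∏ i ∈ (Finset.range n).erase 0, f (2 * i)) * ∏ i ∈ Finset.range n, f (2 * i + 1) := by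
  obtain ⟨m, rfl⟩ := Nat.exists_eq_add_of_lt hn
  simp only [zero_add]
  clear hn
  induction m with
  | zero => simp [show (Finset.range 2).erase 0 = {1} from by decide]
  | succ m ih =>
    rw [show 2 * (m + 1 + 1) = 2 * (m + 1) + 1 + 1 by ring, Finset.range_add_one,
      Finset.erase_insert_of_ne (by omega), Finset.prod_insert (by simp), Finset.range_add_one,
      Finset.erase_insert_of_ne (by omega), Finset.prod_insert (by simp), ih,
      Finset.range_add_one (n := m + 1), Finset.erase_insert_of_ne (by omega),
      Finset.prod_insert (by simp), Finset.prod_insert (by simp)]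
    ac_rfl

theorem natCast_mul_numSpanningTrees_circulantOdd {n k : ℕ} [NeZero (2 * n)] {s : Fin k → ℕ}
    (hinj : Function.Injective s) (h1 : ∀ j, 1 ≤ s j) (h2 : ∀ j, s j < n) {ω : ℂ}
    (hω : ω = ZMod.stdAddChar (1 : ZMod (2 * n))) :
    2 * (n : ℂ) * numSpanningTrees (circulantOdd n s) =
      ∏ i ∈ (Finset.range (2 * n)).erase 0,
        (2 * (k : ℂ) + 1 - ∑ j, ((ω ^ i) ^ s j + ((ω ^ i)⁻¹) ^ s j) - (ω ^ n) ^ i) := by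
  have hn : 0 < n := by have := NeZero.ne (2 * n); omega
  let a : (Fin k ⊕ Fin k) ⊕ Unit → ℕ :=
    Sum.elim (Sum.elim s fun j => 2 * n - s j) fun _ => n
  have ha : Function.Injective a := by
    rintro ((i | i) | i) ((j | j) | j) hij <;> simp only [a, Sum.elim_inl, Sum.elim_inr] at hij
    · rw [hinj hij]
    · have := h2 i; have := h2 j; omega
    · have := h2 i; omega
    · have := h2 i; have := h2 j; omega
    · have := h2 i; have := h2 j
      rw [hinj (show s i = s j by omega)]
    · have := h2 i; omega
    · have := h2 j; omega
    · have := h2 j; omega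
    · rfl
  have hlt : ∀ x, a x < 2 * n := by
    rintro ((i | i) | i) <;> simp only [a, Sum.elim_inl, Sum.elim_inr]
    · have := h2 i; omega
    · have := h1 i; omega
    · omega
  have hpos : ∀ x, a x ≠ 0 := by
    rintro ((i | i) | i) <;> simp only [a, Sum.elim_inl, Sum.elim_inr]
    · have := h1 i; omega
    · have := h2 i; omega
    · omega
  have hneg : ∀ j, ((2 * n - s j : ℕ) : ZMod (2 * n)) = -(s j : ZMod (2 * n)) := by
    intro j
    rw [Nat.cast_sub (by have := h2 j; omega), ZMod.natCast_self, zero_sub]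
  have hnn : (n : ZMod (2 * n)) = -n := by
    rw [eq_neg_iff_add_eq_zero, ← two_mul]
    exact_mod_cast ZMod.natCast_self (2 * n)
  have hJ : Function.Injective fun x => (a x : ZMod (2 * n)) := by
    intro x y hxy
    have := congrArg ZMod.val hxy
    simp only [ZMod.val_natCast_of_lt (hlt _)] at this
    exact ha this
  have hJ0 : ∀ x, (a x : ZMod (2 * n)) ≠ 0 := by
    intro x hx
    have := congrArg ZMod.val hx
    rw [ZMod.val_natCast_of_lt (hlt _), ZMod.val_zero] at this
    exact hpos x this
  have hadj : ∀ u v, (circulantOdd n s).Adj u v ↔ ∃ x, v = u + (a x : ZMod (2 * n)) := by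
    intro u v
    simp only [circulantOdd, SimpleGraph.circulantGraph_adj, Set.mem_union, Set.mem_ofPred_eq,
      Set.mem_singleton_iff]
    constructor
    · rintro ⟨-, (⟨j, hj⟩ | hj) | (⟨j, hj⟩ | hj)⟩
      · exact ⟨.inl (.inr j), by simp only [a, Sum.elim_inl, Sum.elim_inr, hneg, ← hj]; ring⟩
      · exact ⟨.inr (), by simp only [a, Sum.elim_inr]; rw [hnn, ← hj]; ring⟩
      · exact ⟨.inl (.inl j), by simp only [a, Sum.elim_inl, ← hj]; ring⟩
      · exact ⟨.inr (), by simp only [a, Sum.elim_inr, ← hj]; ring⟩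
    · rintro ⟨x, rfl⟩
      refine ⟨fun h => hJ0 x (by simpa using h), ?_⟩
      rcases x with (j | j) | j
      · exact .inr (.inl ⟨j, by simp [a]⟩)
      · exact .inl (.inl ⟨j, by simp only [a, Sum.elim_inl, Sum.elim_inr, hneg]; ring⟩)
      · exact .inr (.inr (by simp [a]))
  have key := card_mul_numSpanningTrees_eq_prod (circulantOdd n s) _ hJ hadj
  rw [prod_univ_erase_zero_eq_prod_range] at key
  push_cast at key
  rw [key]
  refine Finset.prod_congr rfl fun i _ => ?_
  have hchar : ∀ b : ℕ, (ZMod.stdAddChar ((b : ZMod (2 * n)) * (i : ZMod (2 * n))) : ℂ) =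
      (ω ^ i) ^ b := by
    intro b
    rw [hω, ← pow_mul, ← AddChar.map_nsmul_eq_pow]
    congr 1
    simp [mul_comm]
  have hcharneg : ∀ b : ℕ, (ZMod.stdAddChar (-(b : ZMod (2 * n)) * (i : ZMod (2 * n))) : ℂ) =
      ((ω ^ i)⁻¹) ^ b := by
    intro b
    rw [neg_mul, AddChar.map_neg_eq_inv, hchar, inv_pow]
  simp only [Fintype.sum_sum_type, a, Sum.elim_inl, Sum.elim_inr, hneg]
  simp only [hcharneg, hchar, Finset.sum_sub_distrib, Finset.sum_add_distrib,
    Finset.sum_const, Finset.card_univ, Fintype.card_fin, Fintype.card_unit, nsmul_eq_mul,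
    mul_one, one_mul, Nat.cast_one]
  rw [← pow_mul ω n i, mul_comm n i, pow_mul]
  ring

theorem chebyshev_T_eval_half_add_inv {z : ℂ} (hz : z ≠ 0) (n : ℕ) :
    (Polynomial.Chebyshev.T ℂ n).eval ((z + z⁻¹) / 2) = (z ^ n + z⁻¹ ^ n) / 2 := by
  induction n using Nat.twoStepInduction with
  | zero => simp
  | one => simp
  | more n ih1 ih2 =>
    have h := Polynomial.Chebyshev.T_add_two ℂ (n : ℤ)
    push_cast at h ih2 ⊢
    rw [h]
    simp only [Polynomial.eval_sub, Polynomial.eval_mul, Polynomial.eval_X, ih1, ih2,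
      Polynomial.eval_ofNat, inv_pow]
    field_simp
    ring

theorem exists_eq_half_add_inv (x : ℂ) : ∃ z : ℂ, z ≠ 0 ∧ x = (z + z⁻¹) / 2 := by
  obtain ⟨w, hw⟩ := IsAlgClosed.exists_pow_nat_eq (x ^ 2 - 1) (n := 2) two_pos
  have hmul : (x + w) * (x - w) = 1 := by linear_combination -hw
  have hz : x + w ≠ 0 := left_ne_zero_of_mul_eq_one hmul
  refine ⟨x + w, hz, ?_⟩
  rw [inv_eq_of_mul_eq_one_right hmul]
  ring

theorem prod_range_sub_mul_pow {n : ℕ} (hn : 0 < n) {η : ℂ} (hη : IsPrimitiveRoot η n) (z y : ℂ) :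
    ∏ i ∈ Finset.range n, (z - y * η ^ i) = z ^ n - y ^ n := by
  have himage : Polynomial.nthRootsFinset n (1 : ℂ) = (Finset.range n).image fun i => η ^ i := by
    refine (Finset.eq_of_subset_of_card_le (fun μ hμ => ?_) ?_).symm
    · obtain ⟨i, -, rfl⟩ := Finset.mem_image.mp hμ
      rw [Polynomial.mem_nthRootsFinset hn, ← pow_mul, mul_comm, pow_mul, hη.pow_eq_one, one_pow]
    · rw [hη.card_nthRootsFinset, Finset.card_image_of_injOn (by simpa using hη.injOn_pow),
        Finset.card_range]
  rw [hη.pow_sub_pow_eq_prod_sub_mul z y hn, himage,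
    Finset.prod_image (by simpa using hη.injOn_pow)]
  simp only [mul_comm]

/-- The factorization of `T_n - ε` for `ε = ± 1`. -/
theorem chebyshev_T_eval_sub_eq_prod {n : ℕ} (hn : 0 < n) {η ζ ε : ℂ} (hη : IsPrimitiveRoot η n)
    (hζ : ζ ^ n = ε) (hε : ε * ε = 1) (x : ℂ) :
    2 ^ (n - 1) * ∏ i ∈ Finset.range n, (x - (ζ * η ^ i + (ζ * η ^ i)⁻¹) / 2) =
      (Polynomial.Chebyshev.T ℂ n).eval x - ε := by
  obtain ⟨z, hz, rfl⟩ := exists_eq_half_add_inv x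
  have hζ0 : ζ ≠ 0 := by
    rintro rfl
    rw [zero_pow hn.ne'] at hζ
    simp [← hζ] at hε
  have hη0 : η ≠ 0 := hη.ne_zero hn.ne'
  have hinv : ζ⁻¹ ^ n = ε := by rw [inv_pow, hζ, inv_eq_of_mul_eq_one_right hε]
  have hfac : ∀ i, (z + z⁻¹) / 2 - (ζ * η ^ i + (ζ * η ^ i)⁻¹) / 2 =
      (z - ζ * η ^ i) * (z - ζ⁻¹ * η⁻¹ ^ i) * (2 * z)⁻¹ := by
    intro i
    rw [inv_pow]
    field_simp
    ring
  simp only [hfac, Finset.prod_mul_distrib, prod_range_sub_mul_pow hn hη,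
    prod_range_sub_mul_pow hn hη.inv, hζ, hinv, Finset.prod_const, Finset.card_range,
    chebyshev_T_eval_half_add_inv hz]
  obtain ⟨m, rfl⟩ := Nat.exists_eq_add_of_lt hn
  simp only [zero_add, Nat.add_sub_cancel, inv_pow, mul_pow]
  field_simp
  rw [pow_succ]
  linear_combination 2 ^ (m + 1) * hε

theorem prod_eval_eq_prod_roots {ι : Type*} (Q : ℂ[X]) (S : Finset ι) (c : ι → ℂ) :
    ∏ i ∈ S, Q.eval (c i) = Q.leadingCoeff ^ S.card * (-1) ^ (S.card * Q.natDegree) *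
      (Q.roots.map fun v => ∏ i ∈ S, (v - c i)).prod := by
  have hsplit := IsAlgClosed.splits Q
  have hfac : ∀ i, Q.eval (c i) =
      Q.leadingCoeff * (-1) ^ Q.natDegree * (Q.roots.map fun v => v - c i).prod := by
    intro i
    rw [hsplit.eval_eq_prod_roots, hsplit.natDegree_eq_card_roots, mul_assoc,
      ← Multiset.card_map (fun v => v - c i) Q.roots, ← Multiset.prod_map_neg]
    simp
  simp only [hfac, Finset.prod_mul_distrib, Finset.prod_const, ← Multiset.prod_map_prod]
  rw [mul_comm S.card, pow_mul]

section Degree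

variable {k : ℕ} {s : Fin k → ℕ}

theorem natDegree_const_sub_two_mul_sum_chebyshev_T (hk : 0 < k) (hmono : StrictMono s)
    (h1 : ∀ j, 1 ≤ s j) (b : ℂ) :
    (C b - 2 * ∑ j, Polynomial.Chebyshev.T ℂ (s j)).natDegree =
        s ⟨k - 1, Nat.sub_lt hk Nat.one_pos⟩ ∧
      (C b - 2 * ∑ j, Polynomial.Chebyshev.T ℂ (s j)).leadingCoeff =
        -2 ^ s ⟨k - 1, Nat.sub_lt hk Nat.one_pos⟩ := by
  set l : Fin k := ⟨k - 1, Nat.sub_lt hk Nat.one_pos⟩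
  have hdegT : ∀ j, (Polynomial.Chebyshev.T ℂ (s j)).natDegree = s j := fun j => by
    rw [Polynomial.Chebyshev.natDegree_T]; simp
  have hle : (C b - 2 * ∑ j, Polynomial.Chebyshev.T ℂ (s j)).natDegree ≤ s l := by
    refine (natDegree_sub_le _ _).trans (max_le (by simp) ?_)
    rw [← C_ofNat]
    refine (natDegree_C_mul_le _ _).trans (natDegree_sum_le_of_forall_le _ _ fun j _ => ?_)
    rw [hdegT]
    exact hmono.monotone (Fin.mk_le_mk.mpr (Nat.le_sub_one_of_lt j.2))
  have hcoeff : (C b - 2 * ∑ j, Polynomial.Chebyshev.T ℂ (s j)).coeff (s l) = -2 ^ s l := by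
    rw [coeff_sub, coeff_C_of_ne_zero (by have := h1 l; omega), ← C_ofNat, coeff_C_mul,
      finsetSum_coeff, Finset.sum_eq_single l]
    · have := Polynomial.Chebyshev.leadingCoeff_T ℂ (s l)
      rw [leadingCoeff, hdegT] at this
      rw [this]
      simp only [Int.natAbs_natCast]
      rw [zero_sub, mul_comm, ← pow_succ, Nat.sub_add_cancel (h1 l)]
    · intro j _ hj
      refine coeff_eq_zero_of_natDegree_lt ?_
      rw [hdegT]
      refine hmono (lt_of_le_of_ne ?_ hj)
      exact Fin.mk_le_mk.mpr (Nat.le_sub_one_of_lt j.2)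
    · simp
  have hdeg := natDegree_eq_of_le_of_coeff_ne_zero hle (by rw [hcoeff]; simp)
  exact ⟨hdeg, by rw [leadingCoeff, hdeg, hcoeff]⟩

end Degree

/-- Removing a simple root. -/
theorem exists_roots_filter_ne_eq {Q : ℂ[X]} {a : ℂ} (h0 : Q.eval a = 0)
    (h1 : (derivative Q).eval a ≠ 0) :
    ∃ R : ℂ[X], Q = (X - C a) * R ∧ R.eval a = (derivative Q).eval a ∧
      Q.roots.filter (fun u => u ≠ a) = R.roots := by
  obtain ⟨R, rfl⟩ := dvd_iff_isRoot.mpr h0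
  have hR : R.eval a = (derivative ((X - C a) * R)).eval a := by simp
  rw [← hR] at h1
  have hR0 : R ≠ 0 := by rintro rfl; simp at h1
  refine ⟨R, rfl, hR, ?_⟩
  rw [roots_mul (mul_ne_zero (X_sub_C_ne_zero a) hR0), roots_X_sub_C, Multiset.filter_add,
    Multiset.filter_singleton, if_neg (by simp), Multiset.empty_eq_zero, zero_add,
    Multiset.filter_eq_self]
  rintro u hu rfl
  exact h1 ((mem_roots hR0).mp hu)

/-- The factorization of `(T_n - 1) / (X - 1)`, including the value at `1`. -/
theorem chebyshev_T_sub_one_prod_erase {n : ℕ} (hn : 0 < n) {η : ℂ} (hη : IsPrimitiveRoot η n) :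
    (2 ^ (n - 1) * ∏ i ∈ (Finset.range n).erase 0, (1 - (η ^ i + (η ^ i)⁻¹) / 2) = (n : ℂ) ^ 2) ∧
      ∀ x, 2 ^ (n - 1) * ((x - 1) * ∏ i ∈ (Finset.range n).erase 0,
        (x - (η ^ i + (η ^ i)⁻¹) / 2)) = (Polynomial.Chebyshev.T ℂ n).eval x - 1 := by
  have hx : ∀ x, 2 ^ (n - 1) * ((x - 1) * ∏ i ∈ (Finset.range n).erase 0,
      (x - (η ^ i + (η ^ i)⁻¹) / 2)) = (Polynomial.Chebyshev.T ℂ n).eval x - 1 := by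
    intro x
    have h := chebyshev_T_eval_sub_eq_prod hn hη (one_pow n) (one_mul 1) x
    rw [← h, ← Finset.mul_prod_erase _ _ (Finset.mem_range.mpr hn)]
    norm_num
  refine ⟨?_, hx⟩
  have hpoly : C (2 ^ (n - 1)) * ((X - C 1) * ∏ i ∈ (Finset.range n).erase 0,
      (X - C ((η ^ i + (η ^ i)⁻¹) / 2))) = Polynomial.Chebyshev.T ℂ n - C 1 := by
    refine Polynomial.funext fun x => ?_
    rw [eval_mul, eval_mul, eval_prod, eval_sub]
    simpa using hx x
  have hder := congrArg (fun Q => (derivative Q).eval 1) hpoly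
  simpa [Polynomial.Chebyshev.derivative_T_eval_one, eval_prod] using hder

theorem isPrimitiveRoot_stdAddChar_one {N : ℕ} [NeZero N] {ω : ℂ}
    (hω : ω = ZMod.stdAddChar (1 : ZMod N)) : IsPrimitiveRoot ω N := by
  have h := ZMod.stdAddChar_coe (N := N) 1
  rw [Int.cast_one] at h
  rw [hω, h]
  simpa using Complex.isPrimitiveRoot_exp N (NeZero.ne N)

section ProdEval

variable {n d : ℕ} {η : ℂ} {Q : ℂ[X]}

theorem prod_eval_odd {ζ : ℂ} (hn : 0 < n) (hη : IsPrimitiveRoot η n) (hζ : ζ ^ n = -1)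
    (hdeg : Q.natDegree = d) (hlead : Q.leadingCoeff = -2 ^ d) :
    ∏ i ∈ Finset.range n, Q.eval ((ζ * η ^ i + (ζ * η ^ i)⁻¹) / 2) =
      (-1) ^ n * (-1) ^ (n * d) * 2 ^ d *
        (Q.roots.map fun v => (Polynomial.Chebyshev.T ℂ n).eval v + 1).prod := by
  have hcard : Q.roots.card = d := by
    rw [← (IsAlgClosed.splits Q).natDegree_eq_card_roots, hdeg]
  have hfac : ∀ v, (Polynomial.Chebyshev.T ℂ n).eval v + 1 =
      2 ^ (n - 1) * ∏ i ∈ Finset.range n, (v - (ζ * η ^ i + (ζ * η ^ i)⁻¹) / 2) := by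
    intro v
    rw [chebyshev_T_eval_sub_eq_prod hn hη hζ (by norm_num), sub_neg_eq_add]
  simp only [hfac, Multiset.prod_map_mul, Multiset.map_const', Multiset.prod_replicate, hcard]
  rw [prod_eval_eq_prod_roots, hlead, hdeg, Finset.card_range, neg_pow]
  obtain ⟨m, rfl⟩ := Nat.exists_eq_add_of_lt hn
  simp only [zero_add, Nat.add_sub_cancel]
  ring

theorem prod_eval_even {q : ℂ} (hn : 0 < n) (hη : IsPrimitiveRoot η n) (hd : 0 < d)
    (hdeg : Q.natDegree = d) (hlead : Q.leadingCoeff = -2 ^ d) (h0 : Q.eval 1 = 0)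
    (h1 : (derivative Q).eval 1 = -2 * q) (hq : q ≠ 0) :
    q * ∏ i ∈ (Finset.range n).erase 0, Q.eval ((η ^ i + (η ^ i)⁻¹) / 2) =
      (-1) ^ (n * (d - 1)) * 2 ^ (d - 1) * n ^ 2 *
        ((Q.roots.filter fun u => u ≠ 1).map fun u =>
          (Polynomial.Chebyshev.T ℂ n).eval u - 1).prod := by
  obtain ⟨R, hQR, hR1, hroots⟩ := exists_roots_filter_ne_eq h0 (by rw [h1]; simpa using hq)
  obtain ⟨hprod, hfac⟩ := chebyshev_T_sub_one_prod_erase hn hη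
  obtain ⟨e, rfl⟩ := Nat.exists_eq_add_of_lt hd
  obtain ⟨m, rfl⟩ := Nat.exists_eq_add_of_lt hn
  have hR0 : R ≠ 0 := by
    rintro rfl
    rw [eval_zero, h1] at hR1
    simp [hq] at hR1
  have hRdeg : R.natDegree = e := by
    rw [hQR, natDegree_mul (X_sub_C_ne_zero 1) hR0, natDegree_X_sub_C] at hdeg
    omega
  have hRlead : R.leadingCoeff = -2 ^ (e + 1) := by
    rw [hQR, leadingCoeff_mul, leadingCoeff_X_sub_C, one_mul] at hlead
    rw [hlead, zero_add]
  have hcard : R.roots.card = e := by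
    rw [← (IsAlgClosed.splits R).natDegree_eq_card_roots, hRdeg]
  have hq' : -2 * q = -2 ^ (e + 1) * (-1) ^ e * (R.roots.map fun u => u - 1).prod := by
    have h := prod_eval_eq_prod_roots R {()} fun _ => (1 : ℂ)
    simpa [hR1, h1, hRlead, hRdeg] using h
  rw [hroots]
  simp only [← hfac, Multiset.prod_map_mul, Multiset.map_const', Multiset.prod_replicate, hcard]
  have hsplit : ∀ x, Q.eval x = -1 * (1 - x) * R.eval x := by
    intro x
    rw [hQR, eval_mul]
    simp
  simp only [hsplit, Finset.prod_mul_distrib, Finset.prod_const]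
  rw [prod_eval_eq_prod_roots R, hRlead, hRdeg, ← hprod,
    Finset.card_erase_of_mem (by simp), Finset.card_range]
  simp only [zero_add, Nat.add_sub_cancel]
  rw [show q = 2 ^ e * (-1) ^ e * (R.roots.map fun u => u - 1).prod by
    linear_combination (-1 / 2) * hq']
  rw [neg_pow (2 ^ (e + 1) : ℂ) m]
  have hsign : ((-1 : ℂ) ^ m) * (-1) ^ m = 1 := by
    rw [← mul_pow]; norm_num
  generalize (R.roots.map fun u => u - 1).prod = A
  generalize (R.roots.map fun u => ∏ i ∈ (Finset.range (m + 1)).erase 0,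
    (u - (η ^ i + (η ^ i)⁻¹) / 2)).prod = B
  generalize (∏ i ∈ (Finset.range (m + 1)).erase 0, (1 - (η ^ i + (η ^ i)⁻¹) / 2)) = D
  linear_combination (2 ^ e * (-1) ^ e * A * D * (2 ^ (e + 1)) ^ m * (-1) ^ (m * e) * B) * hsign

end ProdEval

/-- the number of spanning trees of `C_{2n}(s_1,…,s_k,n)` equals
`(n · 4^{s_k-1}/q) ∏_p (T_n(u_p) - 1) ∏_p (T_n(v_p) + 1)` where `q = s_1² + … + s_k²`,
`P(w) = 2k + 1 - 2 ∑_{j=1}^k T_{s_j}(w)`, the `u_p` are the roots different from `1`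
(with multiplicity) of `P(u) - 1 = 0`, and the `v_p` are the roots (with multiplicity)
of `P(v) + 1 = 0`. -/
theorem statement12 (n k : ℕ) (hn : 2 ≤ n) (hk : 0 < k) (s : Fin k → ℕ)
    (hmono : StrictMono s) (h1 : ∀ j, 1 ≤ s j) (h2 : ∀ j, s j < n)
    (hgcd : Nat.gcd (Finset.univ.gcd s) n = 1) :
    let P : Polynomial ℂ := C (2 * (k : ℂ) + 1) - 2 * ∑ j : Fin k, Polynomial.Chebyshev.T ℂ (s j)
    (numSpanningTrees (circulantOdd n s) : ℂ) =
      ((n : ℂ) * 4 ^ (s ⟨k - 1, Nat.sub_lt hk Nat.one_pos⟩ - 1) / ∑ j : Fin k, (s j : ℂ) ^ 2) *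
        (((P - 1).roots.filter (fun u => u ≠ 1)).map
          (fun u => (Polynomial.Chebyshev.T ℂ n).eval u - 1)).prod *
        ((P + 1).roots.map
          (fun v => (Polynomial.Chebyshev.T ℂ n).eval v + 1)).prod := by
  intro P
  have hn0 : 0 < n := by omega
  have : NeZero (2 * n) := ⟨by omega⟩
  obtain ⟨ω, hω⟩ : ∃ ω : ℂ, ω = ZMod.stdAddChar (1 : ZMod (2 * n)) := ⟨_, rfl⟩
  have hprim := isPrimitiveRoot_stdAddChar_one hω
  have hω0 : ω ≠ 0 := hprim.ne_zero (by omega)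
  have hη : IsPrimitiveRoot (ω ^ 2) n := hprim.pow (by omega) rfl
  have hωn : ω ^ n = -1 := (hprim.pow (b := 2) (by omega) (mul_comm 2 n)).eq_neg_one_of_two_right
  set d := s ⟨k - 1, Nat.sub_lt hk Nat.one_pos⟩ with hd
  have hd1 : 0 < d := h1 _
  have hP1 : P - 1 = C (2 * (k : ℂ)) - 2 * ∑ j, Polynomial.Chebyshev.T ℂ (s j) := by
    simp only [P, C_add, C_1]; ring
  have hP2 : P + 1 = C (2 * (k : ℂ) + 2) - 2 * ∑ j, Polynomial.Chebyshev.T ℂ (s j) := by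
    rw [show (2 * (k : ℂ) + 2) = 2 * k + 1 + 1 by ring]
    simp only [P, C_add, C_1]; ring
  have hdeg1 := natDegree_const_sub_two_mul_sum_chebyshev_T hk hmono h1 (2 * (k : ℂ))
  have hdeg2 := natDegree_const_sub_two_mul_sum_chebyshev_T hk hmono h1 (2 * (k : ℂ) + 2)
  rw [← hP1, ← hd] at hdeg1
  rw [← hP2, ← hd] at hdeg2
  have hPeval : ∀ z : ℂ, z ≠ 0 →
      P.eval ((z + z⁻¹) / 2) = 2 * k + 1 - ∑ j, (z ^ s j + z⁻¹ ^ s j) := by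
    intro z hz
    simp only [P, eval_sub, eval_C, eval_mul, eval_ofNat, eval_finsetSum,
      chebyshev_T_eval_half_add_inv hz, ← Finset.sum_div]
    ring
  have hq : (∑ j, (s j : ℂ) ^ 2) ≠ 0 := by
    have : 0 < ∑ j, s j ^ 2 :=
      Finset.sum_pos (fun j _ => pow_pos (h1 j) 2) ⟨⟨0, hk⟩, Finset.mem_univ _⟩
    exact_mod_cast this.ne'
  have hP10 : (P - 1).eval 1 = 0 := by
    simp [hP1, eval_finsetSum]
  have hP11 : (derivative (P - 1)).eval 1 = -2 * ∑ j, (s j : ℂ) ^ 2 := by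
    simp [hP1, eval_finsetSum, Polynomial.Chebyshev.derivative_T_eval_one]
  have hcount := natCast_mul_numSpanningTrees_circulantOdd hmono.injective h1 h2 hω
  rw [prod_range_two_mul_erase_zero hn0] at hcount
  have heven := prod_eval_even hn0 hη hd1 hdeg1.1 hdeg1.2 hP10 hP11 hq
  have hodd := prod_eval_odd hn0 hη hωn hdeg2.1 hdeg2.2
  have hevenfac : ∀ i, 2 * (k : ℂ) + 1 - ∑ j, ((ω ^ (2 * i)) ^ s j + ((ω ^ (2 * i))⁻¹) ^ s j) -
      (ω ^ n) ^ (2 * i) = (P - 1).eval (((ω ^ 2) ^ i + ((ω ^ 2) ^ i)⁻¹) / 2) := by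
    intro i
    rw [eval_sub, eval_one, ← pow_mul ω 2, hPeval _ (pow_ne_zero _ hω0), hωn, pow_mul (-1 : ℂ)]
    simp
  have hoddfac : ∀ i, 2 * (k : ℂ) + 1 -
      ∑ j, ((ω ^ (2 * i + 1)) ^ s j + ((ω ^ (2 * i + 1))⁻¹) ^ s j) - (ω ^ n) ^ (2 * i + 1) =
      (P + 1).eval ((ω * (ω ^ 2) ^ i + (ω * (ω ^ 2) ^ i)⁻¹) / 2) := by
    intro i
    rw [eval_add, eval_one, ← pow_mul ω 2, ← pow_succ', hPeval _ (pow_ne_zero _ hω0), hωn,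
      pow_succ (-1 : ℂ), pow_mul (-1 : ℂ)]
    simp
  simp only [hevenfac, hoddfac, hodd] at hcount
  have hn1 : (n : ℂ) ≠ 0 := by exact_mod_cast hn0.ne'
  refine mul_left_cancel₀ (mul_ne_zero two_ne_zero hn1) (hcount.trans ?_)
  refine mul_left_cancel₀ hq ?_
  obtain ⟨e, he⟩ := Nat.exists_eq_add_of_lt hd1
  rw [← mul_assoc, heven, he]
  field_simp
  simp only [zero_add, Nat.add_sub_cancel]
  have h4 : (4 : ℂ) ^ e = 2 ^ e * 2 ^ e := by rw [← mul_pow]; norm_num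
  have hsign : (-1 : ℂ) ^ (n * e) * (-1) ^ n * (-1) ^ (n * (e + 1)) = 1 := by
    rw [← pow_add, mul_add_one, ← mul_pow]
    norm_num
  generalize (((P - 1).roots.filter fun u => u ≠ 1).map fun u =>
    (Polynomial.Chebyshev.T ℂ n).eval u - 1).prod = A
  generalize ((P + 1).roots.map fun v => (Polynomial.Chebyshev.T ℂ n).eval v + 1).prod = B
  rw [h4]
  linear_combination 2 ^ e * 2 ^ (e + 1) * A * B * hsign
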